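/- Let p, q ≥ 1 and let Ω be a proper quasi-homogeneous domain of Ein^{p,q}. If a ∈ ∂Ω is photon-extremal, then C(a) ∩ Ω = ∅. -/

import Mathlib

noncomputable section

open scoped LinearAlgebra.Projectivization ENNReal
open Projectivization Filter Topology Set

variable {W : Type} [AddCommGroup W] [Module ℝ W] [TopologicalSpace W]

instance projTopology : TopologicalSpace (ℙ ℝ W) :=
  inferInstanceAs (TopologicalSpace (Quotient (projectivizationSetoid ℝ W)))

/-- The null cone in projective space determined by a quadratic form `v ↦ Bf v v`. -/
def einSet (Bf : W → W → ℝ) : Set (ℙ ℝ W) := {x | Bf x.rep x.rep = 0}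

/-- The lightcone of a point of the Einstein universe. -/
def lightcone (Bf : W → W → ℝ) (x : ℙ ℝ W) : Set (ℙ ℝ W) :=
  {y | y ∈ einSet Bf ∧ Bf x.rep y.rep = 0}

/-- A domain: nonempty connected open subset of the Einstein universe
(open and connected in the subspace topology of `einSet Bf`). -/
def IsEinDomain (Bf : W → W → ℝ) (Ω : Set (ℙ ℝ W)) : Prop :=
  Ω ⊆ einSet Bf ∧
  IsOpen (Subtype.val ⁻¹' Ω : Set (einSet Bf)) ∧
  IsConnected (Subtype.val ⁻¹' Ω : Set (einSet Bf))

/-- A proper domain: some lightcone misses the closure. -/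
def IsProperDomain (Bf : W → W → ℝ) (Ω : Set (ℙ ℝ W)) : Prop :=
  IsEinDomain Bf Ω ∧ ∃ x ∈ einSet Bf, closure Ω ∩ lightcone Bf x = ∅

/-- The projective transformation induced by a linear automorphism. -/
def projMap (g : W ≃ₗ[ℝ] W) : ℙ ℝ W → ℙ ℝ W :=
  Projectivization.map (g : W →ₗ[ℝ] W) g.injective

/-- The conformal group of a domain. -/
def Conf (Bf : W → W → ℝ) (Ω : Set (ℙ ℝ W)) : Set (W ≃ₗ[ℝ] W) :=
  {g | (∀ v, Bf (g v) (g v) = Bf v v) ∧ projMap g '' Ω = Ω}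

/-- Quasi-homogeneity of a domain. -/
def IsQuasiHomogeneous (Bf : W → W → ℝ) (Ω : Set (ℙ ℝ W)) : Prop :=
  ∃ K : Set (ℙ ℝ W), K ⊆ Ω ∧ IsCompact K ∧
    Ω = ⋃ g ∈ Conf Bf Ω, projMap g '' K

/-- Dual convexity: every frontier point admits a supporting lightcone. -/
def IsDuallyConvex (Bf : W → W → ℝ) (Ω : Set (ℙ ℝ W)) : Prop :=
  ∀ a ∈ closure Ω \ Ω, ∃ b ∈ einSet Bf, a ∈ lightcone Bf b ∧ lightcone Bf b ∩ Ω = ∅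

/-- The hyperbolic distance on the interval `(-1,1)`. -/
def dHyp (s t : ℝ) : ℝ := |Real.log (((1 + t) * (1 - s)) / ((1 - t) * (1 + s)))|

/-- The interval of parameters. -/
def II : Set ℝ := Set.Ioo (-1 : ℝ) 1

/-- A projectively parametrized lightlike geodesic with values in `Ω`. -/
def IsLightGeodesic (Bf : W → W → ℝ) (Ω : Set (ℙ ℝ W)) (α : ℝ → ℙ ℝ W) : Prop :=
  ∃ (u w : W) (a b c d : ℝ),
    LinearIndependent ℝ ![u, w] ∧
    Bf u u = 0 ∧ Bf u w = 0 ∧ Bf w w = 0 ∧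
    a * d - b * c ≠ 0 ∧
    ∀ t ∈ II, ∃ h : (a * t + b) • u + (c * t + d) • w ≠ 0,
      α t = Projectivization.mk ℝ ((a * t + b) • u + (c * t + d) • w) h ∧ α t ∈ Ω

/-- `IsChainCost Bf Ω x y N c` : there is a chain of index `N` from `x` to `y` in `Ω`
whose cost is `c`. -/
def IsChainCost (Bf : W → W → ℝ) (Ω : Set (ℙ ℝ W)) (x y : ℙ ℝ W) (N : ℕ) (c : ℝ) : Prop :=
  ∃ (xs : Fin (N + 1) → ℙ ℝ W) (αs : Fin N → ℝ → ℙ ℝ W) (ss ts : Fin N → ℝ),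
    xs 0 = x ∧ xs (Fin.last N) = y ∧
    (∀ i : Fin N, IsLightGeodesic Bf Ω (αs i) ∧ ss i ∈ II ∧ ts i ∈ II ∧
      αs i (ss i) = xs i.castSucc ∧ αs i (ts i) = xs i.succ) ∧
    c = ∑ i : Fin N, dHyp (ss i) (ts i)

/-- The Markowitz pseudodistance of `Ω`, with values in `[0,∞]`. -/
def markowitz (Bf : W → W → ℝ) (Ω : Set (ℙ ℝ W)) (x y : ℙ ℝ W) : ℝ≥0∞ :=
  sInf {e | ∃ (N : ℕ) (c : ℝ), 1 ≤ N ∧ IsChainCost Bf Ω x y N c ∧ e = ENNReal.ofReal c}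

/-- The Markowitz pseudodistance restricted to chains of index at most `Nmax`. -/
def markowitzN (Bf : W → W → ℝ) (Ω : Set (ℙ ℝ W)) (Nmax : ℕ) (x y : ℙ ℝ W) : ℝ≥0∞ :=
  sInf {e | ∃ (N : ℕ) (c : ℝ), 1 ≤ N ∧ N ≤ Nmax ∧ IsChainCost Bf Ω x y N c ∧
    e = ENNReal.ofReal c}

/-- The projectivization of a linear subspace. -/
def projSet (Pl : Submodule ℝ W) : Set (ℙ ℝ W) := {y | y.rep ∈ Pl}

/-- A photon subspace: a totally isotropic plane. -/
def IsPhotonSub (Bf : W → W → ℝ) (Pl : Submodule ℝ W) : Prop :=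
  Module.finrank ℝ Pl = 2 ∧ ∀ u ∈ Pl, ∀ w ∈ Pl, Bf u w = 0

/-- Photon-extremal points of the frontier of `Ω`. -/
def IsPhotonExtremal (Bf : W → W → ℝ) (Ω : Set (ℙ ℝ W)) (a : ℙ ℝ W) : Prop :=
  a ∈ closure Ω \ Ω ∧
  ∀ Pl : Submodule ℝ W, IsPhotonSub Bf Pl → a.rep ∈ Pl →
    ¬ ∃ U : Set (ℙ ℝ W), IsOpen U ∧ a ∈ U ∧ U ∩ projSet Pl ⊆ closure Ω

/-- A maximal projectively parametrized lightlike geodesic in `Ω`: its image is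
a connected component of `ℙ(Pl) ∩ Ω`. -/
def IsMaxLightGeodesic (Bf : W → W → ℝ) (Ω : Set (ℙ ℝ W)) (α : ℝ → ℙ ℝ W) : Prop :=
  ∃ (u w : W) (a b c d : ℝ),
    LinearIndependent ℝ ![u, w] ∧
    Bf u u = 0 ∧ Bf u w = 0 ∧ Bf w w = 0 ∧
    a * d - b * c ≠ 0 ∧
    (∀ t ∈ II, ∃ h : (a * t + b) • u + (c * t + d) • w ≠ 0,
      α t = Projectivization.mk ℝ ((a * t + b) • u + (c * t + d) • w) h ∧ α t ∈ Ω) ∧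
    α '' II = connectedComponentIn (projSet (Submodule.span ℝ {u, w}) ∩ Ω) (α 0)

/-- The coordinate bilinear form of signature `(p+1, q+1)` on `ℝⁿ`, `n = p+q+2`. -/
def bForm (p q : ℕ) (v w : Fin (p + q + 2) → ℝ) : ℝ :=
  ∑ i : Fin (p + q + 2), (if (i : ℕ) ≤ p then (-1 : ℝ) else 1) * v i * w i

section core

variable {p q : ℕ}

lemma bF_add_left (u v w : Fin (p + q + 2) → ℝ) :
    bForm p q (u + v) w = bForm p q u w + bForm p q v w := by
  simp only [bForm, ← Finset.sum_add_distrib, Pi.add_apply]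
  exact Finset.sum_congr rfl fun i _ => by ring

lemma bF_smul_left (c : ℝ) (v w : Fin (p + q + 2) → ℝ) :
    bForm p q (c • v) w = c * bForm p q v w := by
  simp only [bForm, Finset.mul_sum, Pi.smul_apply, smul_eq_mul]
  exact Finset.sum_congr rfl fun i _ => by ring

lemma bF_comm (v w : Fin (p + q + 2) → ℝ) : bForm p q v w = bForm p q w v := by
  simp only [bForm]
  exact Finset.sum_congr rfl fun i _ => by ring

lemma bF_add_right (u v w : Fin (p + q + 2) → ℝ) :
    bForm p q w (u + v) = bForm p q w u + bForm p q w v := by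
  rw [bF_comm, bF_add_left, bF_comm u, bF_comm v]

lemma bF_smul_right (c : ℝ) (v w : Fin (p + q + 2) → ℝ) :
    bForm p q w (c • v) = c * bForm p q w v := by
  rw [bF_comm, bF_smul_left, bF_comm]

lemma bF_neg_left (v w : Fin (p + q + 2) → ℝ) : bForm p q (-v) w = - bForm p q v w := by
  rw [← neg_one_smul ℝ v, bF_smul_left]; ring

lemma bF_neg_right (v w : Fin (p + q + 2) → ℝ) : bForm p q w (-v) = - bForm p q w v := by
  rw [bF_comm, bF_neg_left, bF_comm]

lemma bF_sub_left (u v w : Fin (p + q + 2) → ℝ) :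
    bForm p q (u - v) w = bForm p q u w - bForm p q v w := by
  rw [sub_eq_add_neg, bF_add_left, bF_neg_left]; ring

lemma bF_sub_right (u v w : Fin (p + q + 2) → ℝ) :
    bForm p q w (u - v) = bForm p q w u - bForm p q w v := by
  rw [sub_eq_add_neg, bF_add_right, bF_neg_right]; ring

lemma bF_zero_left (w : Fin (p + q + 2) → ℝ) : bForm p q 0 w = 0 := by
  simp [bForm]

lemma bF_tendsto {ι : Type*} {l : Filter ι} {f g : ι → Fin (p + q + 2) → ℝ}
    {x y : Fin (p + q + 2) → ℝ} (hf : Tendsto f l (𝓝 x)) (hg : Tendsto g l (𝓝 y)) :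
    Tendsto (fun i => bForm p q (f i) (g i)) l (𝓝 (bForm p q x y)) := by
  have : Continuous fun z : (Fin (p + q + 2) → ℝ) × (Fin (p + q + 2) → ℝ) =>
      bForm p q z.1 z.2 := by
    unfold bForm; fun_prop
  exact (this.tendsto (x, y)).comp (hf.prodMk_nhds hg)

/-- `bForm` as a linear functional -/
def bLin (x : Fin (p + q + 2) → ℝ) : (Fin (p + q + 2) → ℝ) →ₗ[ℝ] ℝ where
  toFun v := bForm p q x v
  map_add' a b := bF_add_right a b x
  map_smul' c v := bF_smul_right c v x

/-- the sign vector -/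
def sgn (p q : ℕ) (i : Fin (p + q + 2)) : ℝ := if (i : ℕ) ≤ p then (-1 : ℝ) else 1

lemma sgn_sq (i : Fin (p + q + 2)) : sgn p q i * sgn p q i = 1 := by
  unfold sgn; split_ifs <;> norm_num

lemma bF_single (v : Fin (p + q + 2) → ℝ) (i : Fin (p + q + 2)) :
    bForm p q v (Pi.single i 1) = sgn p q i * v i := by
  unfold bForm sgn
  rw [Finset.sum_eq_single i]
  · simp
  · intro j _ hj; simp [Pi.single_eq_of_ne hj]
  · simp

lemma bF_nondeg (u : Fin (p + q + 2) → ℝ) (hu : u ≠ 0) : ∃ m, bForm p q m u ≠ 0 := by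
  by_contra! h
  apply hu
  ext i
  have := h (Pi.single i 1)
  rw [bF_comm, bF_single] at this
  have h2 := sgn_sq (p := p) (q := q) i
  rcases mul_eq_zero.1 this with h | h
  · rw [h] at h2; norm_num at h2
  · simpa using h

/-- two orthogonal unit vectors and a linear condition -/
lemma exists_def_vec (i j : Fin (p + q + 2)) (hij : i ≠ j) (h : sgn p q i = sgn p q j)
    (t : Fin (p + q + 2) → ℝ) :
    ∃ v, bForm p q v t = 0 ∧ 0 < sgn p q i * bForm p q v v := by
  have e : ∀ a c : ℝ, bForm p q (a • Pi.single i 1 + c • Pi.single j 1)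
      (a • Pi.single i 1 + c • Pi.single j 1) = sgn p q i * (a^2 + c^2) := by
    intro a c
    simp only [bF_add_right, bF_smul_right, bF_single, Pi.add_apply, Pi.smul_apply, smul_eq_mul,
      Pi.single_eq_same, Pi.single_eq_of_ne hij, Pi.single_eq_of_ne hij.symm, h]
    ring
  have e2 : ∀ a c : ℝ, bForm p q (a • Pi.single i 1 + c • Pi.single j 1) t =
      sgn p q i * (a * t i + c * t j) := by
    intro a c
    rw [bF_comm]
    simp only [bF_add_right, bF_smul_right, bF_single, h]
    ring
  have hs := sgn_sq (p := p) (q := q) i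
  by_cases ht : t i = 0 ∧ t j = 0
  · refine ⟨(1:ℝ) • Pi.single i 1 + (0:ℝ) • Pi.single j 1, ?_, ?_⟩
    · rw [e2, ht.1, ht.2]; ring
    · rw [e, ← mul_assoc, hs]; norm_num
  · refine ⟨(t j) • Pi.single i 1 + (-t i) • Pi.single j 1, ?_, ?_⟩
    · rw [e2]; ring
    · rw [e, ← mul_assoc, hs]
      by_cases h1 : t i = 0
      · have : t j ≠ 0 := fun h2 => ht ⟨h1, h2⟩
        rw [h1]; simp; positivity
      · have : 0 < (t i) ^ 2 := by positivity
        nlinarith [sq_nonneg (t j)]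

/-- the orthogonal complement of a hyperbolic plane contains vectors of both signs -/
lemma exists_pos_neg (hp : 1 ≤ p) (hq : 1 ≤ q) (x y : Fin (p + q + 2) → ℝ)
    (hx : bForm p q x x = 0) (hy : bForm p q y y = 0) (hxy : bForm p q x y = 1) :
    (∃ e, bForm p q x e = 0 ∧ bForm p q y e = 0 ∧ 0 < bForm p q e e) ∧
    (∃ e, bForm p q x e = 0 ∧ bForm p q y e = 0 ∧ bForm p q e e < 0) := by
  have key : ∀ v, bForm p q x (v - bForm p q y v • x - bForm p q x v • y) = 0 ∧
      bForm p q y (v - bForm p q y v • x - bForm p q x v • y) = 0 ∧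
      bForm p q (v - bForm p q y v • x - bForm p q x v • y)
        (v - bForm p q y v • x - bForm p q x v • y) =
        bForm p q v v - 2 * bForm p q x v * bForm p q y v := by
    intro v
    have h1 := bF_comm v x
    have h2 := bF_comm v y
    have h3 := bF_comm y x
    simp only [bF_sub_left, bF_sub_right, bF_smul_left, bF_smul_right, h1, h2, h3, hx, hy, hxy]
    refine ⟨by ring, by ring, by ring⟩
  constructor
  · obtain ⟨v, hv, hv2⟩ := exists_def_vec (p := p) (q := q) ⟨p + 1, by omega⟩ ⟨p + 2, by omega⟩
      (by simp) (by simp [sgn]) (x + y)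
    have : sgn p q ⟨p + 1, by omega⟩ = 1 := by simp [sgn]
    rw [this] at hv2
    obtain ⟨k1, k2, k3⟩ := key v
    refine ⟨_, k1, k2, ?_⟩
    rw [k3]
    rw [bF_add_right, bF_comm v x, bF_comm v y] at hv
    have : bForm p q y v = - bForm p q x v := by linarith
    rw [this]; nlinarith [sq_nonneg (bForm p q x v)]
  · obtain ⟨v, hv, hv2⟩ := exists_def_vec (p := p) (q := q) ⟨0, by omega⟩ ⟨1, by omega⟩
      (by simp) (by simp [sgn, hp]) (x - y)
    have : sgn p q ⟨0, by omega⟩ = -1 := by simp [sgn]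
    rw [this] at hv2
    obtain ⟨k1, k2, k3⟩ := key v
    refine ⟨_, k1, k2, ?_⟩
    rw [k3]
    rw [bF_sub_right, bF_comm v x, bF_comm v y] at hv
    have : bForm p q y v = bForm p q x v := by linarith
    rw [this]; nlinarith [sq_nonneg (bForm p q x v)]

lemma quad_roots (A Bc C : ℝ) (hA : A * C < 0) :
    ∃ t1 t2 : ℝ, t1 ≠ t2 ∧ A + 2 * t1 * Bc + t1 ^ 2 * C = 0 ∧ A + 2 * t2 * Bc + t2 ^ 2 * C = 0 := by
  have hC : C ≠ 0 := by rintro rfl; simp at hA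
  have hD : 0 < Bc ^ 2 - A * C := by nlinarith [sq_nonneg Bc]
  have hs := Real.sq_sqrt hD.le
  have hs0 := Real.sqrt_pos.2 hD
  set s := Real.sqrt (Bc ^ 2 - A * C)
  refine ⟨(-Bc + s) / C, (-Bc - s) / C, ?_, ?_, ?_⟩
  · intro h
    field_simp at h
    linarith
  · field_simp
    linear_combination hs
  · field_simp
    linear_combination hs

/-- A linear map vanishing on all null vectors orthogonal to `x, y` vanishes on all vectors
orthogonal to `x, y`. -/
lemma vanish_perp {V : Type*} [AddCommGroup V] [Module ℝ V]
    (hp : 1 ≤ p) (hq : 1 ≤ q) (x y : Fin (p + q + 2) → ℝ)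
    (hx : bForm p q x x = 0) (hy : bForm p q y y = 0) (hxy : bForm p q x y = 1)
    (F : (Fin (p + q + 2) → ℝ) →ₗ[ℝ] V) (hFy : F y = 0)
    (hF : ∀ u, bForm p q u u = 0 → bForm p q x u = 0 → bForm p q y u = 0 → F u = 0)
    (v : Fin (p + q + 2) → ℝ) (hv : bForm p q y v = 0) : F v = 0 := by
  have main : ∀ v, bForm p q x v = 0 → bForm p q y v = 0 → F v = 0 := by
    intro v hxv hyv
    obtain ⟨⟨e, e1, e2, e3⟩, ⟨f, f1, f2, f3⟩⟩ := exists_pos_neg hp hq x y hx hy hxy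
    have aux : ∀ f, bForm p q x f = 0 → bForm p q y f = 0 →
        bForm p q v v * bForm p q f f < 0 → F v = 0 := by
      intro f f1 f2 hneg
      obtain ⟨t1, t2, hne, h1, h2⟩ := quad_roots (bForm p q v v) (bForm p q v f) (bForm p q f f) hneg
      have g : ∀ t, bForm p q v v + 2 * t * bForm p q v f + t ^ 2 * bForm p q f f = 0 →
          F v + t • F f = 0 := by
        intro t ht
        rw [← map_smul, ← map_add]
        apply hF
        · simp only [bF_add_left, bF_add_right, bF_smul_left, bF_smul_right, bF_comm f v]
          linear_combination ht
        · simp only [bF_add_right, bF_smul_right, hxv, f1]; ring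
        · simp only [bF_add_right, bF_smul_right, hyv, f2]; ring
      have g1 := g t1 h1
      have g2 := g t2 h2
      have : (t1 - t2) • F f = 0 := by
        rw [sub_smul]
        have : t1 • F f - t2 • F f = (F v + t1 • F f) - (F v + t2 • F f) := by abel
        rw [this, g1, g2, sub_zero]
      have hf0 : F f = 0 := (smul_eq_zero.1 this).resolve_left (sub_ne_zero.2 hne)
      simpa [hf0] using g1
    rcases lt_trichotomy (bForm p q v v) 0 with h | h | h
    · exact aux e e1 e2 (mul_neg_of_neg_of_pos h e3)
    · exact hF v h hxv hyv
    · exact aux f f1 f2 (mul_neg_of_pos_of_neg h f3)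
  have h1 : F (v - bForm p q x v • y) = 0 := by
    apply main
    · rw [bF_sub_right, bF_smul_right, hxy]; ring
    · rw [bF_sub_right, bF_smul_right, hy, hv]; ring
  rw [map_sub, map_smul, hFy, smul_zero, sub_zero] at h1
  exact h1

/-- A linear map vanishing on two distinct hyperplanes is zero. -/
lemma vanish_two {V : Type*} [AddCommGroup V] [Module ℝ V]
    (x y u : Fin (p + q + 2) → ℝ) (s : ℝ) (hs : s ≠ 0) (hu : u ≠ 0) 
    (hxy : bForm p q x y = 1) (hxu : bForm p q x u = 0)
    (F : (Fin (p + q + 2) → ℝ) →ₗ[ℝ] V)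
    (h1 : ∀ v, bForm p q y v = 0 → F v = 0)
    (h2 : ∀ v, bForm p q (y + s • u) v = 0 → F v = 0) : F = 0 := by
  obtain ⟨m, hm⟩ := bF_nondeg u hu
  set z := m - bForm p q m (y + s • u) • x with hz
  have z1 : bForm p q (y + s • u) z = 0 := by
    rw [bF_comm, hz, bF_sub_left, bF_smul_left]
    simp only [bF_add_right, bF_smul_right, hxy, hxu]; ring
  have z2 : bForm p q y z = - s * bForm p q m u := by
    rw [bF_comm, hz, bF_sub_left, bF_smul_left]
    simp only [bF_add_right, bF_smul_right, hxy, hxu]; ring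
  have z3 : bForm p q y z ≠ 0 := by rw [z2]; exact mul_ne_zero (neg_ne_zero.2 hs) hm
  ext1 i
  ext
  generalize hvv : (LinearMap.single ℝ (fun _ : Fin (p + q + 2) => ℝ) i) 1 = v
  have e := h1 (v - (bForm p q y v / bForm p q y z) • z) (by
    rw [bF_sub_right, bF_smul_right]; field_simp; ring)
  rw [map_sub, map_smul, h2 z z1, smul_zero, sub_zero] at e
  simpa [← hvv] using e

/-- Existence of a non-zero null vector orthogonal to `x, y`. -/
lemma exists_null (hp : 1 ≤ p) (hq : 1 ≤ q) (x y : Fin (p + q + 2) → ℝ)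
    (hx : bForm p q x x = 0) (hy : bForm p q y y = 0) (hxy : bForm p q x y = 1) :
    ∃ u ≠ 0, bForm p q u u = 0 ∧ bForm p q x u = 0 ∧ bForm p q y u = 0 := by
  by_contra! h
  obtain ⟨⟨e, e1, e2, e3⟩, -⟩ := exists_pos_neg hp hq x y hx hy hxy
  have := vanish_perp hp hq x y hx hy hxy (LinearMap.id - (LinearMap.toSpanSingleton ℝ _ y).comp
      (bLin x)) (by simp [bLin, hxy]) (by
      intro u h1 h2 h3
      by_contra h4
      have : u ≠ 0 := by rintro rfl; simp at h4
      exact h u this h1 h2 h3) e e2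
  simp [bLin, e1] at this
  rw [this, bF_zero_left] at e3
  exact lt_irrefl _ e3

/-- The Eichler transformation. -/
lemma eichler (x y y' u : Fin (p + q + 2) → ℝ)
    (hx : bForm p q x x = 0) (hy : bForm p q y y = 0) (hxy : bForm p q x y = 1)
    (hy' : bForm p q y' y' = 0) (hxy' : bForm p q x y' = 1)
    (hu : bForm p q u u = 0) (hyu : bForm p q y u = 0) (u' : Fin (p + q + 2) → ℝ)
    (hu' : u' = u + bForm p q x u • ((y' - y) - (bForm p q (y' - y) (y' - y) / 2) • x)
      - bForm p q u (y' - y) • x) :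
    bForm p q u' u' = 0 ∧ bForm p q y' u' = 0 ∧ bForm p q x u' = bForm p q x u := by
  have h1 := bF_comm y x
  have h2 := bF_comm y' x
  have h3 := bF_comm u x
  have h4 := bF_comm u y
  have h5 := bF_comm u y'
  have h6 := bF_comm y' y
  subst hu'
  simp only [bF_sub_left, bF_add_left, bF_add_right, bF_sub_right, bF_smul_left, bF_smul_right,
    h1, h2, h3, h4, h5, h6, hx, hy, hxy, hy', hxy', hu, hyu]
  refine ⟨by ring, by ring, by ring⟩

/-- Criterion for a linear map to vanish. -/
lemma vanish_all {V : Type*} [AddCommGroup V] [Module ℝ V]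
    (hp : 1 ≤ p) (hq : 1 ≤ q) (x : Fin (p + q + 2) → ℝ) (hx : bForm p q x x = 0)
    (F : (Fin (p + q + 2) → ℝ) →ₗ[ℝ] V) (P : (Fin (p + q + 2) → ℝ) → Prop)
    (hP : ∀ y, P y → bForm p q y y = 0 ∧ bForm p q x y = 1 ∧ F y = 0 ∧
      ∀ u, bForm p q u u = 0 → bForm p q x u = 0 → bForm p q y u = 0 →
        F u = 0 ∧ ∃ s : ℝ, s ≠ 0 ∧ P (y + s • u))
    (y : Fin (p + q + 2) → ℝ) (hy : P y) : F = 0 := by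
  have key : ∀ y, P y → ∀ v, bForm p q y v = 0 → F v = 0 := by
    intro y hy
    obtain ⟨h1, h2, h3, h4⟩ := hP y hy
    exact vanish_perp hp hq x y hx h1 h2 F h3 fun u a b c => (h4 u a b c).1
  obtain ⟨h1, h2, h3, h4⟩ := hP y hy
  obtain ⟨u, hu0, hu1, hu2, hu3⟩ := exists_null hp hq x y hx h1 h2
  obtain ⟨-, s, hs, hs2⟩ := h4 u hu1 hu2 hu3
  exact vanish_two x y u s hs hu0 h2 hu2 F (key y hy) (key _ hs2)

end core
section core2

variable {p q : ℕ}

lemma step (x0 : Fin (p + q + 2) → ℝ)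
    (S : Set (Fin (p + q + 2) → ℝ)) (hS0 : ∀ v ∈ S, bForm p q v v = 0)
    (hSm : ∀ v ∈ S, ∀ c : ℝ, c ≠ 0 → c • v ∈ S)
    (hSo : ∀ v ∈ S, ∀ᶠ w in 𝓝 v, bForm p q w w = 0 → w ∈ S)
    (hSL : ∀ v ∈ S, bForm p q x0 v ≠ 0) (M : ℝ) (hM : ∀ v ∈ S, ‖v‖ ≤ M * |bForm p q x0 v|)
    (a' : Fin (p + q + 2) → ℝ)
    (hext : ∀ w, w ≠ 0 → bForm p q w w = 0 → bForm p q a' w = 0 → bForm p q x0 w = 0 →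
      ∀ ε > 0, ∃ r : ℝ, |r| < ε ∧ a' + r • w ∉ closure S)
    {ι : Type*} (l : Ultrafilter ι) (G : ι → (Fin (p + q + 2) → ℝ) ≃ₗ[ℝ] (Fin (p + q + 2) → ℝ))
    (hGb : ∀ i v w, bForm p q (G i v) (G i w) = bForm p q v w)
    (hGS : ∀ i, ∀ v ∈ S, G i v ∈ S)
    (y : Fin (p + q + 2) → ℝ) (Y : ι → Fin (p + q + 2) → ℝ) (hy : y ∈ S)
    (hYy : Tendsto Y l (𝓝 y))
    (hlim : Tendsto (fun i => (bForm p q x0 (G i (Y i)))⁻¹ • G i (Y i)) l (𝓝 a'))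
    (u : Fin (p + q + 2) → ℝ) (U : ι → Fin (p + q + 2) → ℝ) (hUu : Tendsto U l (𝓝 u))
    (hev : ∀ᶠ i in l, Y i ∈ S ∧ bForm p q (U i) (U i) = 0 ∧ bForm p q (Y i) (U i) = 0) :
    ∃ ε > 0, (∀ᶠ i in l, ∀ s : ℝ, |s| ≤ ε → Y i + s • U i ∈ S) ∧
      Tendsto (fun i => (bForm p q x0 (G i (Y i)))⁻¹ • G i (U i) -
        ((bForm p q x0 (G i (Y i)))⁻¹ * bForm p q x0 (G i (U i))) •
          ((bForm p q x0 (G i (Y i)))⁻¹ • G i (Y i))) l (𝓝 0) ∧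
      ∀ s : ℝ, |s| ≤ ε / 2 →
        Tendsto (fun i => (bForm p q x0 (G i (Y i + s • U i)))⁻¹ • G i (Y i + s • U i))
          l (𝓝 a') := by
  -- choice of ε
  have hcont : Tendsto (fun z : ((Fin (p + q + 2) → ℝ) × (Fin (p + q + 2) → ℝ)) × ℝ =>
      z.1.1 + z.2 • z.1.2) (𝓝 (y, u) ×ˢ 𝓝 (0:ℝ)) (𝓝 y) := by
    have : Continuous (fun z : ((Fin (p + q + 2) → ℝ) × (Fin (p + q + 2) → ℝ)) × ℝ =>
      z.1.1 + z.2 • z.1.2) := by fun_prop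
    have h := this.tendsto ((y, u), 0)
    rw [nhds_prod_eq] at h
    simpa using h
  obtain ⟨pa, hpa, pb, hpb, hab⟩ := eventually_prod_iff.1 (hcont.eventually (hSo y hy))
  obtain ⟨δ, hδ, hδb⟩ := Metric.eventually_nhds_iff.1 hpb
  set ε := δ / 2 with hε
  have hε0 : 0 < ε := by positivity
  have hpa' := (hYy.prodMk_nhds hUu).eventually hpa
  have hin : ∀ᶠ i in l, ∀ s : ℝ, |s| ≤ ε → Y i + s • U i ∈ S := by
    filter_upwards [hpa', hev] with i h1 h2 s hs
    refine hab h1 (hδb ?_) ?_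
    · rw [Real.dist_eq, sub_zero]; linarith
    · simp only [bF_add_left, bF_add_right, bF_smul_left, bF_smul_right, hS0 _ h2.1, h2.2,
        bF_comm (U i) (Y i)]
      ring
  set lam : ι → ℝ := fun i => bForm p q x0 (G i (Y i)) with hlam
  set mu : ι → ℝ := fun i => bForm p q x0 (G i (U i)) with hmu
  set X : ι → Fin (p + q + 2) → ℝ := fun i => (lam i)⁻¹ • G i (Y i) with hX
  set w : ι → Fin (p + q + 2) → ℝ := fun i =>
    (lam i)⁻¹ • G i (U i) - ((lam i)⁻¹ * mu i) • X i with hw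
  have hlam0 : ∀ᶠ i in l, lam i ≠ 0 := by
    filter_upwards [hev] with i hi
    exact hSL _ (hGS i _ hi.1)
  have hsum : ∀ᶠ i in l, ∀ s : ℝ, |s| ≤ ε → lam i + s * mu i ≠ 0 := by
    filter_upwards [hin] with i hi s hs
    have := hSL _ (hGS i _ (hi s hs))
    rwa [map_add, map_smul, bF_add_right, bF_smul_right] at this
  have hbeta : ∀ᶠ i in l, |(lam i)⁻¹ * mu i| * ε ≤ 1 := by
    filter_upwards [hlam0, hsum] with i h0 hi
    by_contra! hc
    set β := (lam i)⁻¹ * mu i with hβ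
    have hβ0 : β ≠ 0 := by
      intro h; rw [h] at hc; norm_num at hc
    have hm : mu i = lam i * β := by rw [hβ]; field_simp
    refine hi (-β⁻¹) ?_ ?_
    · rw [abs_neg, abs_inv]
      rw [inv_le_iff_one_le_mul₀ (abs_pos.2 hβ0)]
      linarith
    · rw [hm]; field_simp; ring
  have hden : ∀ᶠ i in l, ∀ r : ℝ, |r| ≤ ε / 2 → 1 / 2 ≤ 1 - r * ((lam i)⁻¹ * mu i) := by
    filter_upwards [hbeta] with i hi r hr
    have : |r * ((lam i)⁻¹ * mu i)| ≤ 1 / 2 := by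
      rw [abs_mul]
      nlinarith [abs_nonneg ((lam i)⁻¹ * mu i), abs_nonneg r]
    linarith [le_abs_self (r * ((lam i)⁻¹ * mu i))]
  have hXw : ∀ᶠ i in l, ∀ r : ℝ, |r| ≤ ε / 2 → X i + r • w i ∈ S := by
    filter_upwards [hlam0, hden, hin] with i h0 h1 h2 r hr
    have h3 := h1 r hr
    set β := (lam i)⁻¹ * mu i with hβ
    have hd : 0 < 1 - r * β := by linarith
    have h4 : |r / (1 - r * β)| ≤ ε := by
      rw [abs_div, abs_of_pos hd, div_le_iff₀ hd]
      nlinarith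
    have h5 := hSm _ (hGS i _ (h2 _ h4)) ((lam i)⁻¹ * (1 - r * β))
      (mul_ne_zero (inv_ne_zero h0) hd.ne')
    convert h5 using 1
    rw [map_add, map_smul]
    simp only [hw, hX, ← hβ, smul_sub, smul_add, smul_smul]
    have : (lam i)⁻¹ * (1 - r * β) * (r / (1 - r * β)) = r * (lam i)⁻¹ := by
      field_simp
    rw [this]
    module
  have hLX : ∀ᶠ i in l, bForm p q x0 (X i) = 1 := by
    filter_upwards [hlam0] with i h0
    simp only [hX, bF_smul_right]
    exact inv_mul_cancel₀ h0
  have hLw : ∀ᶠ i in l, bForm p q x0 (w i) = 0 := by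
    filter_upwards [hLX] with i h0
    simp only [hw, bF_sub_right, bF_smul_right _ (X i), h0, bF_smul_right _ (G i (U i))]
    simp [hmu]
  have hXn : ∀ᶠ i in l, ∀ r : ℝ, |r| ≤ ε / 2 → ‖X i + r • w i‖ ≤ M := by
    filter_upwards [hXw, hLX, hLw] with i h1 h2 h3 r hr
    have := hM _ (h1 r hr)
    rw [bF_add_right, bF_smul_right r (w i), h2, h3] at this
    simpa using this
  have hwb : ∀ᶠ i in l, w i ∈ Metric.closedBall (0 : Fin (p + q + 2) → ℝ) (4 * M / ε) := by
    filter_upwards [hXn] with i hi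
    have h1 := hi 0 (by simp; positivity)
    have h2 := hi (ε / 2) (by rw [abs_of_pos]; positivity)
    rw [zero_smul, add_zero] at h1
    rw [mem_closedBall_zero_iff, le_div_iff₀ hε0]
    have h3 : ‖(ε / 2) • w i‖ ≤ 2 * M := by
      have : (ε / 2) • w i = (X i + (ε / 2) • w i) - X i := by abel
      rw [this]
      exact (norm_sub_le _ _).trans (by linarith)
    rw [norm_smul, Real.norm_of_nonneg (by positivity)] at h3
    linarith
  obtain ⟨w0, -, hw0⟩ := (isCompact_closedBall (0 : Fin (p + q + 2) → ℝ) (4 * M / ε)).ultrafilter_le_nhds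
    (l.map w) (le_principal_iff.2 hwb)
  have hwt : Tendsto w l (𝓝 w0) := hw0
  have hw00 : w0 = 0 := by
    by_contra hne
    have e1 : ∀ᶠ i in l, bForm p q (w i) (w i) = 0 ∧ bForm p q (X i) (w i) = 0 := by
      filter_upwards [hev] with i hi
      have k1 : bForm p q (G i (Y i)) (G i (Y i)) = 0 := by rw [hGb, hS0 _ hi.1]
      have k2 : bForm p q (G i (Y i)) (G i (U i)) = 0 := by rw [hGb, hi.2.2]
      have k3 : bForm p q (G i (U i)) (G i (U i)) = 0 := by rw [hGb, hi.2.1]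
      have k4 : bForm p q (G i (U i)) (G i (Y i)) = 0 := by rw [bF_comm, k2]
      simp only [hw, hX, bF_sub_left, bF_sub_right, bF_smul_left, bF_smul_right, k1, k2, k3, k4]
      simp
    have e2 : bForm p q w0 w0 = 0 := tendsto_nhds_unique (bF_tendsto hwt hwt)
      (tendsto_const_nhds.congr' (e1.mono fun i hi => hi.1.symm))
    have e3 : bForm p q a' w0 = 0 := tendsto_nhds_unique (bF_tendsto hlim hwt)
      (tendsto_const_nhds.congr' (e1.mono fun i hi => hi.2.symm))
    have e4 : bForm p q x0 w0 = 0 := tendsto_nhds_unique (bF_tendsto tendsto_const_nhds hwt)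
      (tendsto_const_nhds.congr' (hLw.mono fun i hi => hi.symm))
    obtain ⟨r, hr, hr2⟩ := hext w0 hne e2 e3 e4 (ε / 2) (by positivity)
    apply hr2
    refine mem_closure_of_tendsto (f := fun i => X i + r • w i) (b := (l : Filter ι)) ?_ ?_
    · exact hlim.add (hwt.const_smul r)
    · filter_upwards [hXw] with i hi using hi r hr.le
  rw [hw00] at hwt
  refine ⟨ε, hε0, hin, hwt, ?_⟩
  intro s hs
  have hz : Tendsto (fun i => (s / (1 - (-s) * ((lam i)⁻¹ * mu i))) • w i) l (𝓝 0) := by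
    rw [tendsto_zero_iff_norm_tendsto_zero]
    have hb : Tendsto (fun i => ε * ‖w i‖) l (𝓝 0) := by
      simpa using (hwt.norm).const_mul ε
    refine squeeze_zero' (Eventually.of_forall fun i => norm_nonneg _) ?_ hb
    filter_upwards [hden] with i hi
    rw [norm_smul]
    refine mul_le_mul_of_nonneg_right ?_ (norm_nonneg _)
    have h3 := hi (-s) (by rwa [abs_neg])
    have hd : 0 < 1 - -s * ((lam i)⁻¹ * mu i) := by linarith
    rw [Real.norm_eq_abs, abs_div, abs_of_pos hd, div_le_iff₀ hd]
    nlinarith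
  have hfin := hlim.add hz
  rw [add_zero] at hfin
  refine hfin.congr' ?_
  filter_upwards [hlam0, hden] with i h0 h1
  have h3 := h1 (-s) (by rwa [abs_neg])
  rw [map_add, map_smul, bF_add_right, bF_smul_right]
  change X i + _ = (lam i + s * mu i)⁻¹ • _
  set β := (lam i)⁻¹ * mu i with hβ
  have hd : (1 + s * β) ≠ 0 := by intro h; linarith
  have hm : mu i = lam i * β := by rw [hβ]; field_simp
  have e1 : (lam i + s * mu i)⁻¹ = (1 + s * β)⁻¹ * (lam i)⁻¹ := by
    rw [hm, ← mul_inv]; congr 1; ring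
  have e2 : (1 - -s * β) = 1 + s * β := by ring
  rw [e1, e2]
  simp only [hw, ← hβ]
  have e5 : ((1 + s * β)⁻¹ * (lam i)⁻¹) • (G i (Y i) + s • G i (U i)) =
      (1 + s * β)⁻¹ • X i + ((1 + s * β)⁻¹ * s) • ((lam i)⁻¹ • G i (U i)) := by
    simp only [hX]; module
  rw [e5]
  generalize (lam i)⁻¹ • G i (U i) = gU
  have e3 : X i = ((1 + s * β)⁻¹ * (1 + s * β)) • X i := by rw [inv_mul_cancel₀ hd, one_smul]
  nth_rw 1 [e3]
  rw [div_eq_inv_mul]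
  module

end core2
section core3

variable {p q : ℕ}

theorem core_thm (hp : 1 ≤ p) (hq : 1 ≤ q) (x0 : Fin (p + q + 2) → ℝ)
    (hx0 : bForm p q x0 x0 = 0)
    (S : Set (Fin (p + q + 2) → ℝ)) (hS0 : ∀ v ∈ S, bForm p q v v = 0)
    (hSm : ∀ v ∈ S, ∀ c : ℝ, c ≠ 0 → c • v ∈ S)
    (hSo : ∀ v ∈ S, ∀ᶠ w in 𝓝 v, bForm p q w w = 0 → w ∈ S)
    (hSL : ∀ v ∈ S, bForm p q x0 v ≠ 0) (M : ℝ) (hM : ∀ v ∈ S, ‖v‖ ≤ M * |bForm p q x0 v|)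
    (a' : Fin (p + q + 2) → ℝ) (haa : bForm p q a' a' = 0) (hxa : bForm p q x0 a' = 1)
    (hext : ∀ w, w ≠ 0 → bForm p q w w = 0 → bForm p q a' w = 0 → bForm p q x0 w = 0 →
      ∀ ε > 0, ∃ r : ℝ, |r| < ε ∧ a' + r • w ∉ closure S)
    {ι : Type*} (l : Ultrafilter ι) (G : ι → (Fin (p + q + 2) → ℝ) ≃ₗ[ℝ] (Fin (p + q + 2) → ℝ))
    (hGb : ∀ i v w, bForm p q (G i v) (G i w) = bForm p q v w)
    (hGS : ∀ i, ∀ v ∈ S, G i v ∈ S) (hGS' : ∀ i, ∀ v ∈ S, (G i).symm v ∈ S)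
    (y : Fin (p + q + 2) → ℝ) (Y : ι → Fin (p + q + 2) → ℝ) (hy : y ∈ S)
    (hxy : bForm p q x0 y = 1)
    (hYS : ∀ᶠ i in l, Y i ∈ S ∧ bForm p q x0 (Y i) = 1)
    (hYy : Tendsto Y l (𝓝 y))
    (hlim : Tendsto (fun i => (bForm p q x0 (G i (Y i)))⁻¹ • G i (Y i)) l (𝓝 a'))
    (z : Fin (p + q + 2) → ℝ) (hz : z ∈ S) : bForm p q a' z ≠ 0 := by
  intro haz
  -- the limit operator
  set Gc : ι → (Fin (p + q + 2) → ℝ) →L[ℝ] (Fin (p + q + 2) → ℝ) := fun i =>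
    LinearMap.toContinuousLinearMap (G i : (Fin (p + q + 2) → ℝ) →ₗ[ℝ] (Fin (p + q + 2) → ℝ))
    with hGc
  have hGca : ∀ i v, Gc i v = G i v := fun i v => rfl
  set N : ι → ℝ := fun i => ‖Gc i‖ with hN
  have hy0 : y ≠ 0 := by
    rintro rfl
    rw [bF_comm, bF_zero_left] at hxy
    norm_num at hxy
  have hN0 : ∀ i, 0 < N i := by
    intro i
    rw [hN]
    refine norm_pos_iff.2 fun h => hy0 ?_
    have : G i y = 0 := by rw [← hGca, h]; rfl
    simpa using this
  have : ProperSpace ((Fin (p + q + 2) → ℝ) →L[ℝ] (Fin (p + q + 2) → ℝ)) :=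
    FiniteDimensional.proper ℝ _
  obtain ⟨T, hT1, hT⟩ := (isCompact_sphere
    (0 : (Fin (p + q + 2) → ℝ) →L[ℝ] (Fin (p + q + 2) → ℝ)) 1).ultrafilter_le_nhds
    (l.map fun i => (N i)⁻¹ • Gc i) (by
      refine le_principal_iff.2 (Ultrafilter.mem_coe.2 (Ultrafilter.mem_map.2 ?_))
      refine Filter.univ_mem' fun i => ?_
      simp only [mem_preimage, mem_sphere_zero_iff_norm, norm_smul, norm_inv, Real.norm_eq_abs,
        abs_of_pos (hN0 i)]
      exact inv_mul_cancel₀ (hN0 i).ne')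
  have hT : Tendsto (fun i => (N i)⁻¹ • Gc i) l (𝓝 T) := hT
  have hTne : T ≠ 0 := by
    rintro rfl
    simp at hT1
  have hTev : ∀ (V : ι → Fin (p + q + 2) → ℝ) v, Tendsto V l (𝓝 v) →
      Tendsto (fun i => (N i)⁻¹ • G i (V i)) l (𝓝 (T v)) := by
    intro V v hV
    exact (isBoundedBilinearMap_apply.continuous.tendsto (T, v)).comp (hT.prodMk_nhds hV)
  -- the map which should vanish
  set F : (Fin (p + q + 2) → ℝ) →ₗ[ℝ] (Fin (p + q + 2) → ℝ) :=
    (T : (Fin (p + q + 2) → ℝ) →ₗ[ℝ] (Fin (p + q + 2) → ℝ)) -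
      (LinearMap.toSpanSingleton ℝ _ a').comp ((bLin x0).comp
        (T : (Fin (p + q + 2) → ℝ) →ₗ[ℝ] (Fin (p + q + 2) → ℝ))) with hF
  have hFa : ∀ v, F v = T v - bForm p q x0 (T v) • a' := fun v => by
    simp [hF, bLin]
  have hF0 : F = 0 := by
    refine vanish_all hp hq x0 hx0 F (fun y => y ∈ S ∧ bForm p q x0 y = 1 ∧
      ∃ Y : ι → Fin (p + q + 2) → ℝ, (∀ᶠ i in l, Y i ∈ S ∧ bForm p q x0 (Y i) = 1) ∧
        Tendsto Y l (𝓝 y) ∧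
        Tendsto (fun i => (bForm p q x0 (G i (Y i)))⁻¹ • G i (Y i)) l (𝓝 a')) ?_ y
        ⟨hy, hxy, Y, hYS, hYy, hlim⟩
    clear hlim hYy hYS Y hxy hy hy0 y
    rintro y ⟨hy, hxy, Y, hYS, hYy, hlim⟩
    have hlam0 : ∀ᶠ i in l, bForm p q x0 (G i (Y i)) ≠ 0 := by
      filter_upwards [hYS] with i hi
      exact hSL _ (hGS i _ hi.1)
    have hlamN : Tendsto (fun i => (N i)⁻¹ * bForm p q x0 (G i (Y i))) l
        (𝓝 (bForm p q x0 (T y))) := by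
      refine (bF_tendsto tendsto_const_nhds (hTev Y y hYy)).congr fun i => ?_
      rw [bF_smul_right]
    refine ⟨hS0 y hy, hxy, ?_, ?_⟩
    · rw [hFa, sub_eq_zero]
      refine tendsto_nhds_unique (hTev Y y hYy) ((hlamN.smul hlim).congr' ?_)
      filter_upwards [hlam0] with i hi
      rw [smul_smul]
      congr 1
      field_simp
    · intro u hu hxu hyu
      set U : ι → Fin (p + q + 2) → ℝ := fun i => u + bForm p q x0 u •
        ((Y i - y) - (bForm p q (Y i - y) (Y i - y) / 2) • x0) - bForm p q u (Y i - y) • x0 with hU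
      have hUe : ∀ᶠ i in l, bForm p q (U i) (U i) = 0 ∧ bForm p q (Y i) (U i) = 0 ∧
          bForm p q x0 (U i) = 0 := by
        filter_upwards [hYS] with i hi
        have := eichler x0 y (Y i) u hx0 (hS0 y hy) hxy (hS0 _ hi.1) hi.2 hu hyu (U i) rfl
        rwa [hxu] at this
      have hUu : Tendsto U l (𝓝 u) := by
        have h1 : Tendsto (fun i => bForm p q u (Y i - y) • x0) l (𝓝 0) := by
          have := (bF_tendsto (p := p) (q := q) (tendsto_const_nhds (x := u))
            (hYy.sub_const y)).smul_const x0
          simpa [bF_comm u 0, bF_zero_left] using this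
        have h2 := (tendsto_const_nhds (x := u) (f := (l : Filter ι))).sub h1
        rw [sub_zero] at h2
        refine h2.congr fun i => ?_
        simp [hU, hxu]
      obtain ⟨ε, hε, h1, h2, h3⟩ := step x0 S hS0 hSm hSo hSL M hM a' hext l G hGb hGS y Y hy hYy
        hlim u U hUu (by
          filter_upwards [hYS, hUe] with i a b using ⟨a.1, b.1, b.2.1⟩)
      constructor
      · rw [hFa, sub_eq_zero]
        have hmuN : Tendsto (fun i => (N i)⁻¹ * bForm p q x0 (G i (U i))) l
            (𝓝 (bForm p q x0 (T u))) := by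
          refine (bF_tendsto tendsto_const_nhds (hTev U u hUu)).congr fun i => ?_
          rw [bF_smul_right]
        have h4 := (hlamN.smul h2).add (hmuN.smul hlim)
        rw [smul_zero, zero_add] at h4
        refine tendsto_nhds_unique (hTev U u hUu) (h4.congr' ?_)
        filter_upwards [hlam0] with i hi
        generalize bForm p q x0 (G i (Y i)) = c at hi
        generalize bForm p q x0 (G i (U i)) = d
        have e1 : ((N i)⁻¹ * c) • (c⁻¹ • G i (U i) - (c⁻¹ * d) • c⁻¹ • G i (Y i)) =
            ((N i)⁻¹ * (c * c⁻¹)) • G i (U i) - ((N i)⁻¹ * (c * c⁻¹) * d * c⁻¹) • G i (Y i) := by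
          module
        rw [e1, mul_inv_cancel₀ hi]
        module
      · have hc : Tendsto (fun s : ℝ => y + s • u) (𝓝 0) (𝓝 y) := by
          have : Continuous (fun s : ℝ => y + s • u) := by fun_prop
          simpa using this.tendsto 0
        obtain ⟨δ, hδ, hδb⟩ := Metric.eventually_nhds_iff.1 (hc.eventually (hSo y hy))
        have hs0 : 0 < min (δ / 2) (ε / 2) := by positivity
        set s := min (δ / 2) (ε / 2) with hs
        have hs1 : s ≤ δ / 2 := min_le_left _ _
        have hs2 : s ≤ ε / 2 := min_le_right _ _
        refine ⟨s, hs0.ne', ?_, ?_, fun i => Y i + s • U i, ?_, ?_, ?_⟩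
        · refine hδb ?_ ?_
          · rw [Real.dist_eq, sub_zero, abs_of_pos hs0]; linarith
          · simp only [bF_add_left, bF_add_right, bF_smul_left, bF_smul_right, hS0 _ hy, hu, hyu,
              bF_comm u y]
            ring
        · rw [bF_add_right, bF_smul_right, hxu, hxy]; ring
        · filter_upwards [h1, hYS, hUe] with i a b c
          refine ⟨a s ?_, ?_⟩
          · rw [abs_of_pos hs0]; linarith
          · rw [bF_add_right, bF_smul_right, b.2, c.2.2]; ring
        · exact hYy.add (hUu.const_smul s)
        · exact h3 s (by rw [abs_of_pos hs0]; exact hs2)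
  have hTa : ∀ v, T v = bForm p q x0 (T v) • a' := by
    intro v
    have := hFa v
    rw [hF0] at this
    exact (sub_eq_zero.1 (by simpa using this.symm))
  -- a point of `S` not orthogonal to `a'`
  have ha0 : a' ≠ 0 := by
    rintro rfl
    rw [bF_comm, bF_zero_left] at hxa
    norm_num at hxa
  have hex : ∃ y2 ∈ S, bForm p q a' y2 ≠ 0 := by
    by_contra! hall
    have : bLin (p := p) (q := q) a' = 0 := by
      refine vanish_all hp hq x0 hx0 (bLin a') (fun y => y ∈ S ∧ bForm p q x0 y = 1) ?_ y ⟨hy, hxy⟩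
      clear hlim hYy hYS Y hxy hy hy0 y
      rintro y ⟨hy, hxy⟩
      refine ⟨hS0 y hy, hxy, hall y hy, ?_⟩
      intro u hu hxu hyu
      have hc : Tendsto (fun s : ℝ => y + s • u) (𝓝 0) (𝓝 y) := by
        have : Continuous (fun s : ℝ => y + s • u) := by fun_prop
        simpa using this.tendsto 0
      obtain ⟨δ, hδ, hδb⟩ := Metric.eventually_nhds_iff.1 (hc.eventually (hSo y hy))
      have hmem : y + (δ / 2) • u ∈ S := by
        refine hδb ?_ ?_
        · rw [Real.dist_eq, sub_zero, abs_of_pos (by positivity)]; linarith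
        · simp only [bF_add_left, bF_add_right, bF_smul_left, bF_smul_right, hS0 _ hy, hu, hyu,
            bF_comm u y]
          ring
      have hδ2 : δ / 2 ≠ 0 := by positivity
      refine ⟨?_, δ / 2, hδ2, hmem, ?_⟩
      · have h1 := hall _ hmem
        rw [bF_add_right, bF_smul_right, hall y hy, zero_add] at h1
        exact (mul_eq_zero.1 h1).resolve_left hδ2
      · rw [bF_add_right, bF_smul_right, hxu, hxy]; ring
    obtain ⟨m, hm⟩ := bF_nondeg (p := p) (q := q) a' ha0
    apply hm
    rw [bF_comm]
    exact LinearMap.congr_fun this m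
  obtain ⟨y2, hy2, hay2⟩ := hex
  -- the dual vector
  set c : Fin (p + q + 2) → ℝ := fun i => sgn p q i * bForm p q x0 (T (Pi.single i 1)) with hc
  have hcT : ∀ v, bForm p q c v = bForm p q x0 (T v) := by
    have : bLin (p := p) (q := q) c = (bLin x0).comp
        (T : (Fin (p + q + 2) → ℝ) →ₗ[ℝ] (Fin (p + q + 2) → ℝ)) := by
      ext i
      simp only [LinearMap.comp_apply, LinearMap.single_apply]
      change bForm p q c (Pi.single i 1) = bForm p q x0 (T (Pi.single i 1))
      rw [bF_single, hc, ← mul_assoc, sgn_sq, one_mul]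
    exact fun v => LinearMap.congr_fun this v
  have hc0 : c ≠ 0 := by
    intro h
    apply hTne
    ext1 v
    rw [hTa v, ← hcT v, h, bF_zero_left, zero_smul]
    rfl
  have hGadj : ∀ i v w, bForm p q ((G i).symm v) w = bForm p q v (G i w) := by
    intro i v w
    rw [← hGb i, LinearEquiv.apply_symm_apply]
  have hcl : Tendsto (fun i => (N i)⁻¹ • (G i).symm y2) l (𝓝 (bForm p q a' y2 • c)) := by
    rw [tendsto_pi_nhds]
    intro j
    have h1 := (bF_tendsto (p := p) (q := q) (tendsto_const_nhds (x := y2))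
      (hTev (fun _ => Pi.single j 1) (Pi.single j 1) tendsto_const_nhds)).const_mul (sgn p q j)
    have e : sgn p q j * bForm p q y2 (T (Pi.single j 1)) = (bForm p q a' y2 • c) j := by
      rw [hTa, bF_smul_right, bF_comm y2 a', hc]
      simp only [Pi.smul_apply, smul_eq_mul]
      ring
    rw [e] at h1
    refine h1.congr fun i => ?_
    rw [bF_smul_right, ← hGadj, bF_single, Pi.smul_apply, smul_eq_mul]
    linear_combination (N i)⁻¹ * (G i).symm y2 j * sgn_sq (p := p) (q := q) j
  have hLc : bForm p q x0 c ≠ 0 := by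
    have h1 : ‖bForm p q a' y2 • c‖ ≤ M * |bForm p q x0 (bForm p q a' y2 • c)| := by
      refine le_of_tendsto_of_tendsto' hcl.norm
        ((bF_tendsto tendsto_const_nhds hcl).abs.const_mul M) fun i => ?_
      exact hM _ (hSm _ (hGS' i _ hy2) _ (inv_ne_zero (hN0 i).ne'))
    intro h
    rw [bF_smul_right, h] at h1
    have h2 : bForm p q a' y2 • c = 0 := by
      rw [← norm_le_zero_iff]
      simpa using h1
    exact (smul_ne_zero hay2 hc0) h2
  set κ := bForm p q x0 (T x0) with hκ
  have hκ0 : κ ≠ 0 := by rw [hκ, ← hcT, bF_comm]; exact hLc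
  have hX : Tendsto (fun i => (N i)⁻¹ • G i x0) l (𝓝 (κ • a')) := by
    have := hTev (fun _ => x0) x0 tendsto_const_nhds
    rwa [hTa x0] at this
  have hLX : Tendsto (fun i => bForm p q x0 ((N i)⁻¹ • G i x0)) l (𝓝 κ) := by
    have := bF_tendsto (p := p) (q := q) (tendsto_const_nhds (x := x0)) hX
    rwa [bF_smul_right, hxa, mul_one] at this
  have hLX0 : ∀ᶠ i in l, bForm p q x0 ((N i)⁻¹ • G i x0) ≠ 0 := hLX.eventually_ne hκ0
  set X : ι → Fin (p + q + 2) → ℝ := fun i =>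
    (bForm p q x0 ((N i)⁻¹ • G i x0))⁻¹ • ((N i)⁻¹ • G i x0) with hXd
  have hXa : Tendsto X l (𝓝 a') := by
    have := (hLX.inv₀ hκ0).smul hX
    rwa [smul_smul, inv_mul_cancel₀ hκ0, one_smul] at this
  set Z : ι → Fin (p + q + 2) → ℝ := fun i => z + bForm p q x0 z •
    ((X i - a') - (bForm p q (X i - a') (X i - a') / 2) • x0) - bForm p q z (X i - a') • x0 with hZ
  have hZz : Tendsto Z l (𝓝 z) := by
    have h0 : Tendsto (fun i => X i - a') l (𝓝 0) := by simpa using hXa.sub_const a'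
    have h1 := bF_tendsto (p := p) (q := q) h0 h0
    have h2 := bF_tendsto (p := p) (q := q) (tendsto_const_nhds (x := z)) h0
    have h3 := ((tendsto_const_nhds (x := z) (f := (l : Filter ι))).add
      ((h0.sub ((h1.div_const 2).smul_const x0)).const_smul (bForm p q x0 z))).sub
        (h2.smul_const x0)
    simpa [bF_comm z 0, bF_zero_left] using h3
  have hZe : ∀ᶠ i in l, bForm p q (Z i) (Z i) = 0 ∧ bForm p q (X i) (Z i) = 0 := by
    filter_upwards [hLX0] with i hi
    have := eichler x0 a' (X i) z hx0 haa hxa (by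
      simp only [hXd, bF_smul_left, bF_smul_right, hGb, hx0, mul_zero]) (by
      simp only [hXd]
      rw [bF_smul_right _ ((N i)⁻¹ • G i x0)]
      exact inv_mul_cancel₀ hi) (hS0 z hz) haz (Z i) rfl
    exact ⟨this.1, this.2.1⟩
  have hZS := hZz.eventually (hSo z hz)
  obtain ⟨i, ⟨hi1, hi2⟩, hi3, hi4⟩ := (hZe.and (hZS.and hLX0)).exists
  have h1 := hSL _ (hGS' i _ (hi3 hi1))
  apply h1
  rw [bF_comm, hGadj, bF_comm]
  simp only [hXd, bF_smul_left] at hi2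
  have hNi := inv_ne_zero (hN0 i).ne'
  have := inv_ne_zero hi4
  rcases mul_eq_zero.1 hi2 with h | h
  · exact absurd h this
  · exact (mul_eq_zero.1 h).resolve_left hNi

end core3
section topo

variable {p q : ℕ}

/-- The cone over a subset of projective space. -/
def coneOf {n : ℕ} (O : Set (ℙ ℝ (Fin n → ℝ))) : Set (Fin n → ℝ) :=
  {v | ∃ h : v ≠ 0, Projectivization.mk ℝ v h ∈ O}

lemma isOpen_iff_coneOf {n : ℕ} (O : Set (ℙ ℝ (Fin n → ℝ))) : IsOpen O ↔ IsOpen (coneOf O) := by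
  have h1 : IsOpen O ↔ IsOpen ((fun v : {v : Fin n → ℝ // v ≠ 0} =>
      Projectivization.mk ℝ v.1 v.2) ⁻¹' O) := Iff.rfl
  have h2 : IsOpen {v : Fin n → ℝ | v ≠ 0} := isOpen_ne
  have h3 : coneOf O = Subtype.val '' ((fun v : {v : Fin n → ℝ // v ≠ 0} =>
      Projectivization.mk ℝ v.1 v.2) ⁻¹' O) := by
    ext v
    constructor
    · rintro ⟨h, hv⟩
      exact ⟨⟨v, h⟩, hv, rfl⟩
    · rintro ⟨⟨w, hw⟩, hwO, rfl⟩
      exact ⟨hw, hwO⟩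
  rw [h1, h3]
  exact (IsOpenEmbedding.isOpen_iff_image_isOpen h2.isOpenEmbedding_subtypeVal)

lemma rep_mk {n : ℕ} (v : Fin n → ℝ) (h : v ≠ 0) :
    ∃ c : ℝ, c ≠ 0 ∧ (Projectivization.mk ℝ v h).rep = c • v := by
  obtain ⟨c, hc⟩ := Projectivization.exists_smul_eq_mk_rep ℝ v h
  exact ⟨c, c.ne_zero, hc.symm⟩

lemma mk_smul_eq {n : ℕ} (v : Fin n → ℝ) (h : v ≠ 0) (c : ℝ) (hc : c ≠ 0) (h' : c • v ≠ 0) :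
    Projectivization.mk ℝ (c • v) h' = Projectivization.mk ℝ v h :=
  (Projectivization.mk_eq_mk_iff' ℝ _ _ _ _).2 ⟨c, rfl⟩

lemma rep_mem_coneOf {n : ℕ} (O : Set (ℙ ℝ (Fin n → ℝ))) (x : ℙ ℝ (Fin n → ℝ)) :
    x.rep ∈ coneOf O ↔ x ∈ O := by
  constructor
  · rintro ⟨h, hx⟩; rwa [Projectivization.mk_rep] at hx
  · intro hx; exact ⟨x.rep_nonzero, by rwa [Projectivization.mk_rep]⟩

lemma smul_mem_coneOf {n : ℕ} (O : Set (ℙ ℝ (Fin n → ℝ))) (v : Fin n → ℝ) (hv : v ∈ coneOf O)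
    (c : ℝ) (hc : c ≠ 0) : c • v ∈ coneOf O := by
  obtain ⟨h, hv⟩ := hv
  exact ⟨smul_ne_zero hc h, by rwa [mk_smul_eq v h c hc]⟩

lemma mk_mem_closure {n : ℕ} (O : Set (ℙ ℝ (Fin n → ℝ))) (v : Fin n → ℝ) (h : v ≠ 0)
    (hv : v ∈ closure (coneOf O)) : Projectivization.mk ℝ v h ∈ closure O := by
  rw [mem_closure_iff]
  intro A hA hvA
  obtain ⟨w, ⟨hw1, hw2⟩, hw3, hw4⟩ :=
    mem_closure_iff.1 hv (coneOf A) ((isOpen_iff_coneOf A).1 hA) ⟨h, hvA⟩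
  exact ⟨_, hw2, hw4⟩

lemma mk_mem_ein (v : Fin (p + q + 2) → ℝ) (h : v ≠ 0) :
    Projectivization.mk ℝ v h ∈ einSet (bForm p q) ↔ bForm p q v v = 0 := by
  obtain ⟨c, hc, e⟩ := rep_mk v h
  simp only [einSet, mem_setOf_eq, e, bF_smul_left, bF_smul_right]
  simp [hc]

lemma ein_closed : IsClosed (einSet (bForm p q)) := by
  rw [← isOpen_compl_iff, isOpen_iff_coneOf]
  have h1 : IsOpen {v : Fin (p + q + 2) → ℝ | bForm p q v v ≠ 0} := by
    have : Continuous fun v : Fin (p + q + 2) → ℝ => bForm p q v v := by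
      unfold bForm; fun_prop
    exact isOpen_ne_fun this continuous_const
  convert h1 using 1
  ext v
  constructor
  · rintro ⟨h, hv⟩
    intro h2
    exact hv ((mk_mem_ein v h).2 h2)
  · intro hv
    have h : v ≠ 0 := by rintro rfl; exact hv (bF_zero_left _)
    exact ⟨h, fun h2 => hv ((mk_mem_ein v h).1 h2)⟩

/-- Normalized representative. -/
def nrm (x0 : Fin (p + q + 2) → ℝ) (x : ℙ ℝ (Fin (p + q + 2) → ℝ)) : Fin (p + q + 2) → ℝ :=
  (bForm p q x0 x.rep)⁻¹ • x.rep

lemma nrm_mk (x0 v : Fin (p + q + 2) → ℝ) (h : v ≠ 0) :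
    nrm x0 (Projectivization.mk ℝ v h) = (bForm p q x0 v)⁻¹ • v := by
  obtain ⟨c, hc, e⟩ := rep_mk v h
  rw [nrm, e, bF_smul_right, smul_smul]
  congr 1
  rw [mul_inv, mul_comm c⁻¹, mul_assoc, inv_mul_cancel₀ hc, mul_one]

lemma bF_continuous (x0 : Fin (p + q + 2) → ℝ) : Continuous fun v => bForm p q x0 v := by
  unfold bForm; fun_prop

lemma nrm_tendsto (x0 : Fin (p + q + 2) → ℝ) (a : ℙ ℝ (Fin (p + q + 2) → ℝ))
    (ha : bForm p q x0 a.rep ≠ 0) : Tendsto (nrm x0) (𝓝 a) (𝓝 (nrm x0 a)) := by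
  rw [tendsto_nhds]
  intro V hV haV
  have hcont : ContinuousOn (fun v => (bForm p q x0 v)⁻¹ • v) {v | bForm p q x0 v ≠ 0} := by
    intro v hv
    exact (((bF_continuous x0).continuousAt.inv₀ hv).smul continuousAt_id).continuousWithinAt
  have ho : IsOpen {v | bForm p q x0 v ≠ 0} := isOpen_ne_fun (bF_continuous x0) continuous_const
  have h1 := hcont.isOpen_inter_preimage ho hV
  have h2 : IsOpen {x : ℙ ℝ (Fin (p + q + 2) → ℝ) | bForm p q x0 x.rep ≠ 0 ∧ nrm x0 x ∈ V} := by
    rw [isOpen_iff_coneOf]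
    convert h1 using 1
    ext v
    constructor
    · rintro ⟨h, hv1, hv2⟩
      rw [nrm_mk] at hv2
      refine ⟨?_, hv2⟩
      obtain ⟨c, hc, e⟩ := rep_mk v h
      rw [e, bF_smul_right] at hv1
      exact right_ne_zero_of_mul hv1
    · rintro ⟨hv1, hv2⟩
      have h : v ≠ 0 := by
        rintro rfl
        apply hv1
        change bForm p q x0 0 = 0
        rw [bF_comm, bF_zero_left]
      refine ⟨h, ?_, ?_⟩
      · obtain ⟨c, hc, e⟩ := rep_mk v h
        rw [e, bF_smul_right]
        exact mul_ne_zero hc hv1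
      · rw [nrm_mk]; exact hv2
  exact mem_of_superset (h2.mem_nhds ⟨ha, haV⟩) fun x hx => hx.2

lemma ext_vec (Ω : Set (ℙ ℝ (Fin (p + q + 2) → ℝ))) (a : ℙ ℝ (Fin (p + q + 2) → ℝ))
    (ha : IsPhotonExtremal (bForm p q) Ω a) (x0 : Fin (p + q + 2) → ℝ)
    (ha0 : bForm p q x0 a.rep ≠ 0) (hrr : bForm p q a.rep a.rep = 0)
    (w : Fin (p + q + 2) → ℝ) (hw : w ≠ 0) (hww : bForm p q w w = 0)
    (haw : bForm p q (nrm x0 a) w = 0) (hxw : bForm p q x0 w = 0) (ε : ℝ) (hε : 0 < ε) :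
    ∃ r : ℝ, |r| < ε ∧ nrm x0 a + r • w ∉ closure (coneOf Ω) := by
  by_contra! hall
  set a' := nrm x0 a with ha'
  have hrep : a.rep = bForm p q x0 a.rep • a' := by
    rw [ha', nrm, smul_smul, mul_inv_cancel₀ ha0, one_smul]
  have haa : bForm p q a' a' = 0 := by
    rw [ha', nrm, bF_smul_left, bF_smul_right, hrr]; ring
  have hxa : bForm p q x0 a' = 1 := by
    rw [ha', nrm, bF_smul_right, inv_mul_cancel₀ ha0]
  obtain ⟨i, hi⟩ := Function.ne_iff.1 hw
  have hi : w i ≠ 0 := hi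
  have hli : LinearIndependent ℝ ![a', w] := by
    rw [LinearIndependent.pair_iff]
    intro s t h
    have h1 : bForm p q x0 (s • a' + t • w) = 0 := by rw [h, bF_comm, bF_zero_left]
    rw [bF_add_right, bF_smul_right, bF_smul_right, hxa, hxw] at h1
    have hs : s = 0 := by linarith
    refine ⟨hs, ?_⟩
    rw [hs, zero_smul, zero_add] at h
    exact (smul_eq_zero.1 h).resolve_right hw
  refine ha.2 (Submodule.span ℝ {a', w}) ⟨?_, ?_⟩ ?_ ⟨{x | |x.rep i - bForm p q x0 x.rep * a' i| <
      ε * |w i| * |bForm p q x0 x.rep|}, ?_, ?_, ?_⟩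
  · have h := finrank_span_eq_card hli
    have e : Set.range ![a', w] = {a', w} := by
      ext v
      simp [eq_comm]
      exact or_comm
    rw [e] at h
    simpa using h
  · intro u hu v hv
    obtain ⟨s, t, rfl⟩ := Submodule.mem_span_pair.1 hu
    obtain ⟨s', t', rfl⟩ := Submodule.mem_span_pair.1 hv
    simp only [bF_add_left, bF_add_right, bF_smul_left, bF_smul_right, haa, hww, haw,
      bF_comm w a']
    ring
  · rw [hrep]
    exact Submodule.smul_mem _ _ (Submodule.subset_span (by simp))
  · rw [isOpen_iff_coneOf]
    have h1 : IsOpen {v : Fin (p + q + 2) → ℝ | |v i - bForm p q x0 v * a' i| <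
        ε * |w i| * |bForm p q x0 v|} := by
      have := bF_continuous (p := p) (q := q) x0
      exact isOpen_lt (by fun_prop) (by fun_prop)
    convert h1 using 1
    have key : ∀ (v : Fin (p + q + 2) → ℝ) (h : v ≠ 0),
        (|(Projectivization.mk ℝ v h).rep i -
          bForm p q x0 (Projectivization.mk ℝ v h).rep * a' i| <
          ε * |w i| * |bForm p q x0 (Projectivization.mk ℝ v h).rep| ↔
        |v i - bForm p q x0 v * a' i| < ε * |w i| * |bForm p q x0 v|) := by
      intro v h
      obtain ⟨c, hc, e⟩ := rep_mk v h
      rw [e, bF_smul_right, Pi.smul_apply, smul_eq_mul]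
      have e1 : c * v i - c * bForm p q x0 v * a' i = c * (v i - bForm p q x0 v * a' i) := by ring
      have e2 : ε * |w i| * |c * bForm p q x0 v| = |c| * (ε * |w i| * |bForm p q x0 v|) := by
        rw [abs_mul]; ring
      rw [e1, e2, abs_mul]
      exact mul_lt_mul_iff_right₀ (abs_pos.2 hc)
    ext v
    constructor
    · rintro ⟨h, hv⟩
      exact (key v h).1 hv
    · intro hv
      have h : v ≠ 0 := by
        rintro rfl
        have hv : |(0 : Fin (p + q + 2) → ℝ) i - bForm p q x0 0 * a' i| <
          ε * |w i| * |bForm p q x0 0| := hv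
        rw [bF_comm, bF_zero_left] at hv
        simp at hv
      exact ⟨h, (key v h).2 hv⟩
  · have e : a.rep i - bForm p q x0 a.rep * a' i = 0 := by
      have := congrFun hrep i
      rw [Pi.smul_apply, smul_eq_mul] at this
      linarith
    change |a.rep i - bForm p q x0 a.rep * a' i| < _
    rw [e, abs_zero]
    positivity
  · rintro x ⟨hx1, hx2⟩
    obtain ⟨s, t, hst⟩ := Submodule.mem_span_pair.1 hx2
    have hx1 : |x.rep i - bForm p q x0 x.rep * a' i| < ε * |w i| * |bForm p q x0 x.rep| := hx1
    have e1 : bForm p q x0 x.rep = s := by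
      rw [← hst, bF_add_right, bF_smul_right, bF_smul_right, hxa, hxw]; ring
    have e2 : x.rep i - s * a' i = t * w i := by
      rw [← hst]; simp
    rw [e1, e2, abs_mul] at hx1
    have hwi := abs_pos.2 hi
    have h3 : |t| < ε * |s| := by
      by_contra! hc
      nlinarith
    have hs : s ≠ 0 := by
      rintro rfl
      simp at h3
      exact absurd h3 (not_lt.2 (abs_nonneg t))
    have h4 : |t / s| < ε := by
      rw [abs_div, div_lt_iff₀ (abs_pos.2 hs)]; exact h3
    have h5 := hall _ h4
    have e3 : x.rep = s • (a' + (t / s) • w) := by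
      rw [← hst, smul_add, smul_smul, mul_div_cancel₀ _ hs]
    have h6 : a' + (t / s) • w ≠ 0 := by
      intro h
      apply x.rep_nonzero
      rw [e3, h, smul_zero]
    have h7 := mk_mem_closure Ω _ h6 h5
    have e4 : Projectivization.mk ℝ _ h6 = x := by
      rw [← x.mk_rep, Projectivization.mk_eq_mk_iff']
      exact ⟨s⁻¹, by rw [e3, smul_smul, inv_mul_cancel₀ hs, one_smul]⟩
    rwa [e4] at h7

end topo

/-- The lightcone of a photon-extremal point of a proper
quasi-homogeneous domain misses the domain. -/
theorem stmt_13 (p q : ℕ) (hp : 1 ≤ p) (hq : 1 ≤ q)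
    (Ω : Set (ℙ ℝ (Fin (p + q + 2) → ℝ)))
    (hΩ : IsProperDomain (bForm p q) Ω)
    (hqh : IsQuasiHomogeneous (bForm p q) Ω)
    (a : ℙ ℝ (Fin (p + q + 2) → ℝ)) (ha : IsPhotonExtremal (bForm p q) Ω a) :
    lightcone (bForm p q) a ∩ Ω = ∅ := by
  obtain ⟨⟨hΩe, hΩo, hΩc⟩, x, hx, hxΩ⟩ := hΩ
  obtain ⟨K, hKΩ, hK, hΩK⟩ := hqh
  set x0 := x.rep with hx0d
  have hx0 : bForm p q x0 x0 = 0 := hx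
  set S := coneOf Ω with hS
  have hclE : closure Ω ⊆ einSet (bForm p q) := closure_minimal hΩe ein_closed
  have hclL : ∀ y ∈ closure Ω, bForm p q x0 y.rep ≠ 0 := by
    intro y hy h
    have : y ∈ closure Ω ∩ lightcone (bForm p q) x := ⟨hy, hclE hy, h⟩
    rw [hxΩ] at this
    exact this
  have hclLv : ∀ v ∈ closure S, v ≠ 0 → bForm p q x0 v ≠ 0 := by
    intro v hv h
    have h1 := hclL _ (mk_mem_closure Ω v h hv)
    obtain ⟨c, hc, e⟩ := rep_mk v h
    rw [e, bF_smul_right] at h1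
    exact right_ne_zero_of_mul h1
  have hSne : ∀ v ∈ S, v ≠ 0 := fun v hv => hv.1
  have hS0 : ∀ v ∈ S, bForm p q v v = 0 := by
    rintro v ⟨h, hv⟩
    exact (mk_mem_ein v h).1 (hΩe hv)
  have hSL : ∀ v ∈ S, bForm p q x0 v ≠ 0 := fun v hv => hclLv v (subset_closure hv) (hSne v hv)
  have hSm : ∀ v ∈ S, ∀ c : ℝ, c ≠ 0 → c • v ∈ S := fun v hv c hc => smul_mem_coneOf Ω v hv c hc
  obtain ⟨O, hO, hOΩ⟩ := isOpen_induced_iff.1 hΩo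
  have hSo : ∀ v ∈ S, ∀ᶠ w in 𝓝 v, bForm p q w w = 0 → w ∈ S := by
    rintro v ⟨h, hv⟩
    have h1 : Projectivization.mk ℝ v h ∈ O := by
      have : (⟨_, hΩe hv⟩ : einSet (bForm p q)) ∈ Subtype.val ⁻¹' O := by rw [hOΩ]; exact hv
      exact this
    filter_upwards [((isOpen_iff_coneOf O).1 hO).mem_nhds ⟨h, h1⟩] with w hw hw0
    obtain ⟨h2, h3⟩ := hw
    refine ⟨h2, ?_⟩
    have : (⟨_, (mk_mem_ein w h2).2 hw0⟩ : einSet (bForm p q)) ∈ Subtype.val ⁻¹' Ω := by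
      rw [← hOΩ]; exact h3
    exact this
  have hΩne : Ω.Nonempty := by
    obtain ⟨y, hy⟩ := hΩc.nonempty
    exact ⟨_, hy⟩
  have hbound : ∃ M : ℝ, ∀ v ∈ S, ‖v‖ ≤ M * |bForm p q x0 v| := by
    have hcomp : IsCompact (Metric.sphere (0 : Fin (p + q + 2) → ℝ) 1 ∩ closure S) :=
      (isCompact_sphere _ _).inter_right isClosed_closure
    have hunit : ∀ v ∈ S, ‖v‖⁻¹ • v ∈ Metric.sphere (0 : Fin (p + q + 2) → ℝ) 1 ∩ closure S := by
      intro v hv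
      have h1 : ‖v‖ ≠ 0 := norm_ne_zero_iff.2 (hSne v hv)
      refine ⟨?_, subset_closure (hSm v hv _ (inv_ne_zero h1))⟩
      rw [mem_sphere_zero_iff_norm, norm_smul, norm_inv, norm_norm, inv_mul_cancel₀ h1]
    obtain ⟨y, hy⟩ := hΩne
    obtain ⟨m, hm, hmin⟩ := hcomp.exists_isMinOn ⟨_, hunit _ ((rep_mem_coneOf Ω y).2 hy)⟩
      ((bF_continuous (p := p) (q := q) x0).abs.continuousOn)
    have hm0 : m ≠ 0 := by
      rintro rfl
      simp at hm
    have hmp : 0 < |bForm p q x0 m| := abs_pos.2 (hclLv m hm.2 hm0)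
    refine ⟨|bForm p q x0 m|⁻¹, fun v hv => ?_⟩
    have h1 : |bForm p q x0 m| ≤ |bForm p q x0 (‖v‖⁻¹ • v)| := hmin (hunit v hv)
    have h2 : 0 < ‖v‖ := norm_pos_iff.2 (hSne v hv)
    rw [bF_smul_right, abs_mul, abs_of_pos (inv_pos.2 h2), ← div_eq_inv_mul, le_div_iff₀ h2] at h1
    rw [← div_eq_inv_mul, le_div_iff₀ hmp]
    linarith
  obtain ⟨M, hM⟩ := hbound
  have hacl : a ∈ closure Ω := ha.1.1
  have haL := hclL a hacl
  have haQ : bForm p q a.rep a.rep = 0 := hclE hacl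
  obtain ⟨l, hlΩ, hla⟩ := mem_closure_iff_ultrafilter.1 hacl
  have hpick : ∀ x : ℙ ℝ (Fin (p + q + 2) → ℝ), ∃ g ∈ Conf (bForm p q) Ω, ∃ k ∈ K,
      x ∈ Ω → projMap g k = x := by
    have h0 : ∀ x ∈ Ω, ∃ g ∈ Conf (bForm p q) Ω, ∃ k ∈ K, projMap g k = x := by
      intro x hx
      rw [hΩK] at hx
      simp only [mem_iUnion] at hx
      obtain ⟨g, hg, k, hk, e⟩ := hx
      exact ⟨g, hg, k, hk, e⟩
    intro x
    by_cases hx : x ∈ Ω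
    · obtain ⟨g, hg, k, hk, e⟩ := h0 x hx
      exact ⟨g, hg, k, hk, fun _ => e⟩
    · obtain ⟨y, hy⟩ := hΩne
      obtain ⟨g, hg, k, hk, e⟩ := h0 y hy
      exact ⟨g, hg, k, hk, fun h => absurd h hx⟩
  choose G hG k hk hGk using hpick
  obtain ⟨k0, hk0, hkk⟩ := hK.ultrafilter_le_nhds (l.map k)
    (le_principal_iff.2 (Ultrafilter.mem_coe.2 (Ultrafilter.mem_map.2
      (Filter.univ_mem' fun i => hk i))))
  have hkt : Tendsto k l (𝓝 k0) := hkk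
  have hnS : ∀ y ∈ Ω, nrm x0 y ∈ S := by
    intro y hy
    exact hSm _ ((rep_mem_coneOf Ω y).2 hy) _ (inv_ne_zero (hclL y (subset_closure hy)))
  have hnL : ∀ y ∈ closure Ω, bForm p q x0 (nrm x0 y) = 1 := by
    intro y hy
    rw [nrm, bF_smul_right, inv_mul_cancel₀ (hclL y hy)]
  have hGb : ∀ i v w, bForm p q (G i v) (G i w) = bForm p q v w := by
    intro i v w
    have h1 := (hG i).1 (v + w)
    have h2 := (hG i).1 v
    have h3 := (hG i).1 w
    rw [map_add] at h1
    simp only [bF_add_left, bF_add_right] at h1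
    rw [bF_comm (G i w) (G i v), bF_comm w v] at h1
    linarith
  have hmap : ∀ i (v : Fin (p + q + 2) → ℝ) (h : v ≠ 0) (h' : G i v ≠ 0),
      projMap (G i) (Projectivization.mk ℝ v h) = Projectivization.mk ℝ (G i v) h' := by
    intro i v h h'
    rfl
  have hGne : ∀ i (v : Fin (p + q + 2) → ℝ), v ≠ 0 → G i v ≠ 0 := by
    intro i v h h2
    exact h (by simpa using h2)
  have hGS : ∀ i, ∀ v ∈ S, G i v ∈ S := by
    rintro i v ⟨h, hv⟩
    refine ⟨hGne i v h, ?_⟩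
    rw [← hmap i v h, ← (hG i).2]
    exact ⟨_, hv, rfl⟩
  have hGS' : ∀ i, ∀ v ∈ S, (G i).symm v ∈ S := by
    rintro i v ⟨h, hv⟩
    rw [← (hG i).2] at hv
    obtain ⟨y, hy, e⟩ := hv
    rw [← y.mk_rep, hmap i _ y.rep_nonzero (hGne i _ y.rep_nonzero),
      Projectivization.mk_eq_mk_iff'] at e
    obtain ⟨c, hc⟩ := e
    have hc0 : c ≠ 0 := by
      rintro rfl
      rw [zero_smul] at hc
      exact hGne i _ y.rep_nonzero hc.symm
    have e2 : (G i).symm v = c⁻¹ • y.rep := by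
      rw [LinearEquiv.symm_apply_eq, map_smul, ← hc, smul_smul, inv_mul_cancel₀ hc0, one_smul]
    rw [e2]
    exact hSm _ ((rep_mem_coneOf Ω y).2 hy) _ (inv_ne_zero hc0)
  have hmkn : ∀ y ∈ Ω, ∀ h : nrm x0 y ≠ 0, Projectivization.mk ℝ (nrm x0 y) h = y := by
    intro y hy h
    conv_rhs => rw [← y.mk_rep]
    exact (Projectivization.mk_eq_mk_iff' ℝ _ _ _ _).2 ⟨_, rfl⟩
  have hfin := core_thm hp hq x0 hx0 S hS0 hSm hSo hSL M hM (nrm x0 a)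
    (by rw [nrm, bF_smul_left, bF_smul_right, haQ]; ring) (hnL a hacl)
    (fun w h1 h2 h3 h4 ε hε => ext_vec Ω a ha x0 haL haQ w h1 h2 h3 h4 ε hε)
    l G hGb hGS hGS' (nrm x0 k0) (fun i => nrm x0 (k i)) (hnS k0 (hKΩ hk0))
    (hnL k0 (subset_closure (hKΩ hk0)))
    (Eventually.of_forall fun i => ⟨hnS _ (hKΩ (hk i)), hnL _ (subset_closure (hKΩ (hk i)))⟩)
    ((nrm_tendsto x0 k0 (hclL k0 (subset_closure (hKΩ hk0)))).comp hkt)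
    (by
      have h1 : Tendsto (nrm x0) l (𝓝 (nrm x0 a)) := (nrm_tendsto x0 a haL).mono_left hla
      refine h1.congr' ?_
      filter_upwards [hlΩ] with i hi
      have h2 : nrm x0 (k i) ≠ 0 := hSne _ (hnS _ (hKΩ (hk i)))
      rw [← nrm_mk x0 _ (hGne i _ h2), ← hmap i _ h2, hmkn _ (hKΩ (hk i)), hGk i hi])
  rw [eq_empty_iff_forall_notMem]
  rintro z ⟨hz1, hz2⟩
  refine hfin z.rep ((rep_mem_coneOf Ω z).2 hz2) ?_
  rw [nrm, bF_smul_left, hz1.2, mul_zero]
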